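/- (a) limsup_{t→∞} V(t) < ∞ if and only if there exists a positive integer k such that p_{j+k}/p_j ≤ 1/2 for all j ≥ 1. (b) If for some positive integer k, limsup_{j→∞} p_{j+k}/p_j ≤ 1/2, then limsup_{t→∞} V(t) ≤ k. -/

import Mathlib

open Filter Topology

/-- Poissonized variance `V(t) = ∑_j (e^{-t p_j} − e^{-2 t p_j})`. -/
noncomputable def Vpois (p : ℕ → ℝ) (t : ℝ) : ℝ :=
  ∑' j, (Real.exp (-t * p j) - Real.exp (-2 * t * p j))

noncomputable def fF (x : ℝ) : ℝ := Real.exp (-x) - Real.exp (-2 * x)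

lemma fF_eq (x : ℝ) : fF x = Real.exp (-x) * (1 - Real.exp (-x)) := by
  unfold fF
  have : Real.exp (-2 * x) = Real.exp (-x) * Real.exp (-x) := by
    rw [← Real.exp_add]; ring_nf
  rw [this]; ring

lemma fF_nonneg {x : ℝ} (hx : 0 ≤ x) : 0 ≤ fF x := by
  unfold fF
  have : Real.exp (-2 * x) ≤ Real.exp (-x) := Real.exp_le_exp.2 (by linarith)
  linarith

lemma fF_le {x : ℝ} (hx : 0 ≤ x) : fF x ≤ x := by
  rw [fF_eq]
  have h1 : Real.exp (-x) ≤ 1 := Real.exp_le_one_iff.2 (by linarith)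
  have h2 := Real.add_one_le_exp (-x)
  have h3 := Real.exp_pos (-x)
  nlinarith

lemma fF_le_one {x : ℝ} (hx : 0 ≤ x) : fF x ≤ 1 := by
  unfold fF
  have h1 : Real.exp (-x) ≤ 1 := Real.exp_le_one_iff.2 (by linarith)
  have h3 := Real.exp_pos (-2 * x)
  linarith

lemma Vpois_eq (p : ℕ → ℝ) (t : ℝ) : Vpois p t = ∑' j, fF (t * p j) := by
  unfold Vpois fF
  congr 1; ext j; ring_nf

lemma fF_summable {p : ℕ → ℝ} (hpos : ∀ j, 0 < p j) (hs : Summable p) {t : ℝ} (ht : 0 ≤ t) :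
    Summable (fun j => fF (t * p j)) :=
  Summable.of_nonneg_of_le (fun j => fF_nonneg (mul_nonneg ht (hpos j).le))
    (fun j => fF_le (mul_nonneg ht (hpos j).le)) (hs.mul_left t)

lemma Vpois_le {p : ℕ → ℝ} (hpos : ∀ j, 0 < p j) (hs : Summable p)
    (hsum : ∑' j, p j = 1) {t : ℝ} (ht : 0 ≤ t) : Vpois p t ≤ t := by
  rw [Vpois_eq]
  calc _ ≤ ∑' j, t * p j := Summable.tsum_le_tsum
        (fun j => fF_le (mul_nonneg ht (hpos j).le)) (fF_summable hpos hs ht) (hs.mul_left t)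
    _ = t := by rw [tsum_mul_left, hsum, mul_one]

lemma tele (e : ℕ → ℝ) (k N : ℕ) :
    ∑ i ∈ Finset.range N, (e (i + k) - e i) = ∑ i ∈ Finset.range k, (e (N + i) - e i) := by
  rw [Finset.sum_sub_distrib, Finset.sum_sub_distrib]
  have h1 := Finset.sum_range_add e k N
  have h2 := Finset.sum_range_add e N k
  rw [add_comm N k] at h2
  simp only [add_comm _ k] at *
  linarith

lemma err_le {x ε : ℝ} :
    Real.exp (-x) - Real.exp (-(2 * (1 / 2 + ε) * x)) ≤ 2 * ε * (x * Real.exp (-x)) := by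
  have : Real.exp (-(2 * (1 / 2 + ε) * x)) = Real.exp (-x) * Real.exp (-(2 * ε * x)) := by
    rw [← Real.exp_add]; ring_nf
  rw [this]
  have h2 := Real.add_one_le_exp (-(2 * ε * x))
  have h3 := Real.exp_pos (-x)
  nlinarith

lemma xexp_le {x : ℝ} : x * Real.exp (-x) ≤ 2 * fF (x / 2) := by
  unfold fF
  have h : Real.exp (-(x / 2)) = Real.exp (-x) * Real.exp (x / 2) := by
    rw [← Real.exp_add]; ring_nf
  have h' : -2 * (x / 2) = -x := by ring
  rw [h', h]
  have h2 := Real.add_one_le_exp (x / 2)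
  have h3 := Real.exp_pos (-x)
  nlinarith

lemma key {p : ℕ → ℝ} (hpos : ∀ j, 0 < p j) (hs : Summable p) {k J : ℕ} {ε : ℝ} (hε : 0 ≤ ε)
    (hr : ∀ j, J ≤ j → p (j + k) ≤ (1 / 2 + ε) * p j) {t : ℝ} (ht : 0 ≤ t) :
    Vpois p t ≤ ∑ i ∈ Finset.range (J + k), fF (t * p i) + k + 4 * ε * Vpois p (t / 2) := by
  have ht2 : 0 ≤ t / 2 := by linarith
  have hn : ∀ j, 0 ≤ fF (t * p j) := fun j => fF_nonneg (mul_nonneg ht (hpos j).le)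
  rw [Vpois_eq p t]
  refine Real.tsum_le_of_sum_range_le hn fun N => ?_
  have h0 : ∑ i ∈ Finset.range N, fF (t * p i) ≤ ∑ i ∈ Finset.range (J + k + N), fF (t * p i) :=
    Finset.sum_le_sum_of_subset_of_nonneg (Finset.range_subset_range.2 (by omega)) (fun i _ _ => hn i)
  rw [Finset.sum_range_add] at h0
  have h1 : ∀ i ∈ Finset.range N, fF (t * p (J + k + i)) ≤
      (Real.exp (-(t * p (J + (i + k)))) - Real.exp (-(t * p (J + i)))) +
        4 * ε * fF (t / 2 * p (J + i)) := by
    intro i _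
    have e1 : J + k + i = J + i + k := by ring
    have e2 : J + (i + k) = J + i + k := by ring
    rw [e1, e2]
    have a := hr (J + i) (by omega)
    have b := @err_le (t * p (J + i)) ε
    have c := @xexp_le (t * p (J + i))
    have d : Real.exp (-(2 * (1 / 2 + ε) * (t * p (J + i)))) ≤
        Real.exp (-2 * (t * p (J + i + k))) := by
      apply Real.exp_le_exp.2
      nlinarith [mul_le_mul_of_nonneg_left a ht]
    have e3 : t / 2 * p (J + i) = t * p (J + i) / 2 := by ring
    rw [e3]
    have c' := mul_le_mul_of_nonneg_left c (by linarith : 0 ≤ 2 * ε)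
    rw [fF.eq_1 (t * p (J + i + k))]
    linarith
  have h2 := Finset.sum_le_sum h1
  rw [Finset.sum_add_distrib, ← Finset.mul_sum,
    tele (fun i => Real.exp (-(t * p (J + i)))) k N] at h2
  have h3 : ∑ i ∈ Finset.range k, (Real.exp (-(t * p (J + (N + i)))) - Real.exp (-(t * p (J + i))))
      ≤ k := by
    calc _ ≤ ∑ i ∈ Finset.range k, (1 : ℝ) := by
          apply Finset.sum_le_sum
          intro i _
          have h1 : Real.exp (-(t * p (J + (N + i)))) ≤ 1 :=
            Real.exp_le_one_iff.2 (by have := mul_nonneg ht (hpos (J + (N + i))).le; linarith)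
          have h3 := Real.exp_pos (-(t * p (J + i)))
          linarith
      _ = k := by simp
  have h4 : ∑ i ∈ Finset.range N, fF (t / 2 * p (J + i)) ≤ Vpois p (t / 2) := by
    rw [Vpois_eq]
    have hn2 : ∀ j, 0 ≤ fF (t / 2 * p j) := fun j => fF_nonneg (mul_nonneg ht2 (hpos j).le)
    have a := (fF_summable hpos hs ht2).sum_le_tsum (Finset.range (J + N)) (fun i _ => hn2 i)
    rw [Finset.sum_range_add] at a
    have := Finset.sum_nonneg (s := Finset.range J) (fun i _ => hn2 i)
    linarith
  have h5 := mul_le_mul_of_nonneg_left h4 (by linarith : 0 ≤ 4 * ε)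
  linarith

lemma partB {p : ℕ → ℝ} (hpos : ∀ j, 0 < p j) (hs : Summable p) (hsum : ∑' j, p j = 1) (k : ℕ)
    (h : ∀ ε : ℝ, 0 < ε → ∀ᶠ j in atTop, p (j + k) / p j ≤ 1 / 2 + ε) :
    ∀ ε : ℝ, 0 < ε → ∀ᶠ t in atTop, Vpois p t ≤ (k : ℝ) + ε := by
  have h' : ∀ ε : ℝ, 0 < ε → ∃ J, ∀ j, J ≤ j → p (j + k) ≤ (1 / 2 + ε) * p j := by
    intro ε hε
    obtain ⟨J, hJ⟩ := eventually_atTop.1 (h ε hε)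
    exact ⟨J, fun j hj => (div_le_iff₀ (hpos j)).1 (hJ j hj)⟩
  obtain ⟨B, hB1, hB⟩ : ∃ B : ℝ, 1 ≤ B ∧ ∀ t, 0 ≤ t → Vpois p t ≤ B := by
    obtain ⟨J, hJ⟩ := h' (1 / 8) (by norm_num)
    refine ⟨1 + 2 * (J + 2 * k), by have := J.cast_nonneg (α := ℝ); have := k.cast_nonneg (α := ℝ); linarith, ?_⟩
    have ind : ∀ n : ℕ, ∀ t : ℝ, 0 ≤ t → t ≤ 2 ^ n → Vpois p t ≤ 1 + 2 * (J + 2 * k) := by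
      intro n
      induction n with
      | zero =>
        intro t ht ht1
        have := Vpois_le hpos hs hsum ht
        have := J.cast_nonneg (α := ℝ)
        have := k.cast_nonneg (α := ℝ)
        norm_num at ht1
        linarith
      | succ n ih =>
        intro t ht ht1
        have a := ih (t / 2) (by linarith) (by rw [pow_succ] at ht1; linarith)
        have b := key hpos hs (by norm_num) hJ ht
        have c : ∑ i ∈ Finset.range (J + k), fF (t * p i) ≤ (J + k : ℝ) := by
          calc _ ≤ ∑ i ∈ Finset.range (J + k), (1 : ℝ) :=
                Finset.sum_le_sum fun i _ => fF_le_one (mul_nonneg ht (hpos i).le)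
            _ = _ := by simp
        linarith
    intro t ht
    obtain ⟨n, hn⟩ := pow_unbounded_of_one_lt t (by norm_num : (1 : ℝ) < 2)
    exact ind n t ht hn.le
  intro ε hε
  have hBp : 0 < B := by linarith
  obtain ⟨J, hJ⟩ := h' (ε / (8 * B)) (by positivity)
  have hlim : Tendsto (fun t : ℝ => ∑ i ∈ Finset.range (J + k), fF (t * p i)) atTop (𝓝 0) := by
    rw [show (0 : ℝ) = ∑ i ∈ Finset.range (J + k), (0 : ℝ) by simp]
    apply tendsto_finsetSum
    intro i _
    have hx : Tendsto (fun t : ℝ => Real.exp (-(t * p i))) atTop (𝓝 0) :=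
      Real.tendsto_exp_neg_atTop_nhds_zero.comp (tendsto_id.atTop_mul_const (hpos i))
    have := hx.mul (hx.const_sub 1)
    simp only [zero_mul] at this
    exact this.congr fun t => (fF_eq _).symm
  filter_upwards [hlim.eventually (gt_mem_nhds (by linarith : 0 < ε / 2)), eventually_ge_atTop 0]
    with t h1 ht
  have b := key hpos hs (by positivity) hJ ht
  have c := mul_le_mul_of_nonneg_left (hB (t / 2) (by linarith))
    (by positivity : 0 ≤ 4 * (ε / (8 * B)))
  have d : 4 * (ε / (8 * B)) * B = ε / 2 := by field_simp; norm_num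
  linarith

lemma partA {p : ℕ → ℝ} (hpos : ∀ j, 0 < p j) (hmono : Antitone p) (hs : Summable p)
    (hsum : ∑' j, p j = 1) (C : ℝ) (hC : ∀ᶠ t in atTop, Vpois p t ≤ C) :
    ∃ k : ℕ, 0 < k ∧ ∀ j : ℕ, p (j + k) / p j ≤ 1 / 2 := by
  obtain ⟨T, hT⟩ := eventually_atTop.1 hC
  have hB : ∀ t, 0 ≤ t → Vpois p t ≤ max C T := by
    intro t ht
    rcases le_total T t with h | h
    · exact (hT t h).trans (le_max_left _ _)
    · exact (Vpois_le hpos hs hsum ht).trans (h.trans (le_max_right _ _))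
  set c : ℝ := Real.exp (-1) * (1 - Real.exp (-(1 / 2))) with hc
  have hcpos : 0 < c := by
    have : Real.exp (-(1 / 2 : ℝ)) < 1 := Real.exp_lt_one_iff.2 (by norm_num)
    exact mul_pos (Real.exp_pos _) (by linarith)
  obtain ⟨k, hk⟩ := exists_nat_gt (max C T / c)
  refine ⟨k + 1, by omega, fun j => ?_⟩
  by_contra! hcon
  have hpj := hpos j
  rw [lt_div_iff₀ hpj] at hcon
  have ht : 0 ≤ 1 / p j := by positivity
  have hn : ∀ i, 0 ≤ fF (1 / p j * p i) := fun i => fF_nonneg (mul_nonneg ht (hpos i).le)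
  have a := (fF_summable hpos hs ht).sum_le_tsum (Finset.range (j + k)) (fun i _ => hn i)
  rw [← Vpois_eq, Finset.sum_range_add] at a
  have b := Finset.sum_nonneg (s := Finset.range j) (fun i _ => hn i)
  have d : ∑ i ∈ Finset.range k, c ≤ ∑ i ∈ Finset.range k, fF (1 / p j * p (j + i)) := by
    apply Finset.sum_le_sum
    intro i hi
    have hi := Finset.mem_range.1 hi
    have u : p (j + i) ≤ p j := hmono (by omega)
    have l : p (j + (k + 1)) ≤ p (j + i) := hmono (by omega)
    have u' : 1 / p j * p (j + i) ≤ 1 := by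
      rw [one_div_mul_eq_div, div_le_one hpj]; exact u
    have l' : 1 / 2 ≤ 1 / p j * p (j + i) := by
      rw [one_div_mul_eq_div, le_div_iff₀ hpj]; linarith
    rw [fF_eq, hc]
    have e1 : Real.exp (-1) ≤ Real.exp (-(1 / p j * p (j + i))) := Real.exp_le_exp.2 (by linarith)
    have e2 : Real.exp (-(1 / p j * p (j + i))) ≤ Real.exp (-(1 / 2)) :=
      Real.exp_le_exp.2 (by linarith)
    have e3 : Real.exp (-(1 / 2 : ℝ)) < 1 := Real.exp_lt_one_iff.2 (by norm_num)
    exact mul_le_mul e1 (by linarith) (by linarith) (Real.exp_pos _).le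
  simp only [Finset.sum_const, Finset.card_range, nsmul_eq_mul] at d
  rw [div_lt_iff₀ hcpos] at hk
  linarith [hB _ ht]

/-- (a) `limsup_{t→∞} V(t) < ∞` iff there is a positive integer `k` with
`p_{j+k}/p_j ≤ 1/2` for all `j`. (b) If `limsup_j p_{j+k}/p_j ≤ 1/2` for some
positive integer `k`, then `limsup_{t→∞} V(t) ≤ k`. -/
theorem stmt_13 (p : ℕ → ℝ) (hpos : ∀ j, 0 < p j) (hmono : Antitone p)
    (hsum : ∑' j, p j = 1) :
    ((∃ C : ℝ, ∀ᶠ t in atTop, Vpois p t ≤ C) ↔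
      ∃ k : ℕ, 0 < k ∧ ∀ j : ℕ, p (j + k) / p j ≤ 1 / 2) ∧
    (∀ k : ℕ, 0 < k →
      (∀ ε : ℝ, 0 < ε → ∀ᶠ j in atTop, p (j + k) / p j ≤ 1 / 2 + ε) →
      ∀ ε : ℝ, 0 < ε → ∀ᶠ t in atTop, Vpois p t ≤ (k : ℝ) + ε) := by
  have hs : Summable p := by
    by_contra h
    rw [tsum_eq_zero_of_not_summable h] at hsum
    norm_num at hsum
  refine ⟨⟨fun ⟨C, hC⟩ => partA hpos hmono hs hsum C hC, fun ⟨k, _, h⟩ => ?_⟩,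
    fun k _ h => partB hpos hs hsum k h⟩
  exact ⟨k + 1, partB hpos hs hsum k
    (fun ε hε => Eventually.of_forall fun j => (h j).trans (by linarith)) 1 one_pos⟩
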